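/- Let E be a finite homogeneous effect algebra such that S(E) = {0, 1}, and let a be an atom of E. Suppose n ≥ 1 and n·a is well defined. If [0, n·a] ≠ {0, a, 2·a, …, n·a}, then there exists an atom b of E such that b ∈ [0, n·a] and b ≠ a. -/

import Mathlib

namespace EffectAlgebraPaper

/-- An effect algebra: a set with 0, 1 and a partially defined sum `add`,
whose domain is the relation `Orth` (written `a ⊥ b` in the paper). -/
class EffectAlgebra (E : Type*) where
  zero : E
  one : E
  /-- `Orth a b` means `a ⊕ b` is defined. -/
  Orth : E → E → Prop
  /-- The sum `a ⊕ b`, meaningful only when `Orth a b`. -/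
  add : E → E → E
  orth_comm : ∀ a b : E, Orth a b → Orth b a
  add_comm : ∀ a b : E, Orth a b → add a b = add b a
  assoc : ∀ a b c : E, Orth b c → Orth a (add b c) →
    Orth a b ∧ Orth (add a b) c ∧ add a (add b c) = add (add a b) c
  compl_exists : ∀ a : E, ∃! b : E, Orth a b ∧ add a b = one
  orth_one : ∀ a : E, Orth a one → a = zero

namespace EffectAlgebra

variable {E : Type*} [EffectAlgebra E]

/-- The orthosupplement `a'`. -/
noncomputable def compl (a : E) : E := (compl_exists a).exists.choose

/-- The effect-algebra partial order: `a ≤ b` iff `a ⊕ c = b` for some `c`. -/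
def le (a b : E) : Prop := ∃ c : E, Orth a c ∧ add a c = b

/-- The interval `[x, y] = {z : x ≤ z ≤ y}`. -/
def Interval (x y : E) : Set E := { z : E | le x z ∧ le z y }

/-- An atom: a minimal nonzero element. -/
def Atom (a : E) : Prop := a ≠ zero ∧ ∀ b : E, b ≠ zero → le b a → b = a

/-- A sharp element: the only common lower bound of `x` and `x'` is `0`. -/
def Sharp (x : E) : Prop := ∀ b : E, le b x → le b (compl x) → b = zero

/-- `S(E)`, the set of sharp elements. -/
def sharpSet (E : Type*) [EffectAlgebra E] : Set E := { x : E | Sharp x }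

/-- Homogeneity: `u ≤ v₁ ⊕ v₂ ≤ u'` implies `u = u₁ ⊕ u₂` with `u₁ ≤ v₁`, `u₂ ≤ v₂`. -/
def Homogeneous (E : Type*) [EffectAlgebra E] : Prop :=
  ∀ u v₁ v₂ : E, Orth v₁ v₂ → le u (add v₁ v₂) → le (add v₁ v₂) (compl u) →
    ∃ u₁ u₂ : E, le u₁ v₁ ∧ le u₂ v₂ ∧ Orth u₁ u₂ ∧ add u₁ u₂ = u

/-- `nmul n a` is the iterated sum `n·a = a ⊕ ⋯ ⊕ a` (`n` times), with `0·a = 0`;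
it is meaningful only when `nmulDef n a` holds. -/
def nmul : ℕ → E → E
  | 0, _ => zero
  | n + 1, a => add (nmul n a) a

/-- `nmulDef n a` says the iterated sum `n·a` is well defined. -/
def nmulDef : ℕ → E → Prop
  | 0, _ => True
  | n + 1, a => nmulDef n a ∧ Orth (nmul n a) a

end EffectAlgebra

namespace EffectAlgebra

variable {E : Type*} [EffectAlgebra E]

theorem orth_zero_one : Orth (zero : E) one := by
  obtain ⟨b, hb, -⟩ := (compl_exists (one : E)).exists
  have h := orth_comm _ _ hb
  rwa [orth_one b h] at h

theorem zero_add_one : add (zero : E) one = one := by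
  obtain ⟨b, hb, hb'⟩ := (compl_exists (one : E)).exists
  have h := orth_comm _ _ hb
  rwa [add_comm _ _ hb, orth_one b h] at hb'

theorem zero_orth_and_zero_add (a : E) : Orth zero a ∧ add zero a = a := by
  obtain ⟨b, hb, hb'⟩ := (compl_exists a).exists
  obtain ⟨h₁, h₂, h₃⟩ := assoc zero a b hb (hb' ▸ orth_zero_one)
  rw [hb', zero_add_one] at h₃
  refine ⟨h₁, (compl_exists b).unique ⟨orth_comm _ _ h₂, ?_⟩ ⟨orth_comm _ _ hb, ?_⟩⟩
  · rw [← add_comm _ _ h₂, h₃]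
  · rw [← add_comm _ _ hb, hb']

theorem orth_zero (a : E) : Orth a zero := orth_comm _ _ (zero_orth_and_zero_add a).1

theorem add_zero (a : E) : add a zero = a := by
  rw [add_comm _ _ (orth_zero a), (zero_orth_and_zero_add a).2]

theorem add_left_cancel {a b c : E} (hb : Orth a b) (hc : Orth a c)
    (h : add a b = add a c) : b = c := by
  obtain ⟨d, hd, hd'⟩ := (compl_exists (add a b)).exists
  have hdb := orth_comm _ _ hd
  rw [add_comm _ _ hd] at hd'
  obtain ⟨-, h₁, h₂⟩ := assoc d a b hb hdb
  obtain ⟨-, h₃, h₄⟩ := assoc d a c hc (h ▸ hdb)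
  exact (compl_exists (add d a)).unique ⟨h₁, h₂ ▸ hd'⟩ ⟨h₃, by rw [← h₄, ← h, hd']⟩

theorem eq_zero_of_add_eq_zero {a b : E} (hab : Orth a b) (h : add a b = zero) :
    a = zero :=
  orth_one a (orth_comm _ _ (assoc one a b hab (h ▸ orth_zero one)).1)

theorem assoc_right {a b c : E} (hab : Orth a b) (habc : Orth (add a b) c) :
    Orth b c ∧ Orth a (add b c) ∧ add (add a b) c = add a (add b c) := by
  have hba := orth_comm _ _ hab
  have hcab := orth_comm _ _ habc
  rw [add_comm _ _ hab] at hcab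
  obtain ⟨h₁, h₂, h₃⟩ := assoc c b a hba hcab
  have h₁' := orth_comm _ _ h₁
  rw [add_comm _ _ h₁] at h₂ h₃
  refine ⟨h₁', orth_comm _ _ h₂, ?_⟩
  rw [add_comm _ _ habc, add_comm _ _ hab, h₃, add_comm _ _ h₂]

theorem zero_le (a : E) : le zero a := ⟨a, zero_orth_and_zero_add a⟩

theorem le_refl (a : E) : le a a := ⟨zero, orth_zero a, add_zero a⟩

theorem le_trans {a b c : E} : le a b → le b c → le a c := by
  rintro ⟨d, hd, rfl⟩ ⟨e, he, rfl⟩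
  obtain ⟨-, h₂, h₃⟩ := assoc_right hd he
  exact ⟨add d e, h₂, h₃.symm⟩

theorem le_antisymm {a b : E} : le a b → le b a → a = b := by
  rintro ⟨d, hd, rfl⟩ ⟨e, he, h⟩
  obtain ⟨h₁, h₂, h₃⟩ := assoc_right hd he
  have hde : add d e = zero :=
    add_left_cancel h₂ (orth_zero a) (by rw [← h₃, h, add_zero])
  rw [eq_zero_of_add_eq_zero h₁ hde, add_zero]

theorem exists_atom_le [Finite E] {x : E} (hx : x ≠ zero) : ∃ b, Atom b ∧ le b x := by
  let r : E → E → Prop := fun y z => le y z ∧ y ≠ z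
  have : IsTrans E r := ⟨fun y z w h₁ h₂ => ⟨le_trans h₁.1 h₂.1, by
    rintro rfl
    exact h₁.2 (le_antisymm h₁.1 h₂.1)⟩⟩
  have : Std.Irrefl r := ⟨fun y h => h.2 rfl⟩
  obtain ⟨b, ⟨hb, hbx⟩, hmin⟩ := (Finite.wellFounded_of_trans_of_irrefl r).has_min
    {y | y ≠ zero ∧ le y x} ⟨x, hx, le_refl x⟩
  refine ⟨b, ⟨hb, fun c hc hcb => ?_⟩, hbx⟩
  by_contra hne
  exact hmin c ⟨hc, le_trans hcb hbx⟩ ⟨hcb, hne⟩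

theorem nmul_le_nmul {a : E} {m n : ℕ} (hmn : m ≤ n) (hdef : nmulDef n a) :
    le (nmul m a) (nmul n a) := by
  induction n, hmn using Nat.le_induction with
  | base => exact le_refl _
  | succ k _ ih => exact le_trans (ih hdef.1) ⟨a, hdef.2, rfl⟩

/-- If `a` is the only atom below `n·a`, then every element below `n·a` is a multiple of `a`. -/
theorem exists_eq_nmul_of_le [Finite E] {a : E} {n : ℕ} (hdef : nmulDef n a)
    (hatom : ∀ b, Atom b → le b (nmul n a) → b = a) {x : E} (hx : le x (nmul n a)) :
    ∃ m ≤ n, x = nmul m a := by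
  induction n with
  | zero => exact ⟨0, le_rfl, le_antisymm hx (zero_le _)⟩
  | succ n ih =>
    have hle : le (nmul n a) (nmul (n + 1) a) := ⟨a, hdef.2, rfl⟩
    obtain ⟨y, hxy, hsum⟩ := hx
    by_cases hy : y = zero
    · exact ⟨n + 1, le_rfl, by rw [← hsum, hy, add_zero]⟩
    obtain ⟨b, hb, hby⟩ := exists_atom_le hy
    have hyn : le y (nmul (n + 1) a) :=
      ⟨x, orth_comm _ _ hxy, by rw [← add_comm _ _ hxy, hsum]⟩
    obtain rfl := hatom b hb (le_trans hby hyn)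
    obtain ⟨z, hbz, rfl⟩ := hby
    rw [add_comm _ _ hbz] at hxy hsum
    obtain ⟨hxz, hxzb, h⟩ := assoc x z b (orth_comm _ _ hbz) hxy
    have hxn : add x z = nmul n b := by
      refine add_left_cancel (orth_comm _ _ hxzb) (orth_comm _ _ hdef.2) ?_
      rw [← add_comm _ _ hxzb, ← add_comm _ _ hdef.2, ← h, hsum, nmul]
    obtain ⟨m, hm, rfl⟩ :=
      ih hdef.1 (fun c hc hcn => hatom c hc (le_trans hcn hle)) ⟨z, hxz, hxn⟩
    exact ⟨m, by omega, rfl⟩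

end EffectAlgebra

open EffectAlgebra

/-- Lemma 8 (lem33): in a finite homogeneous effect algebra with `S(E) = {0, 1}`,
if `a` is an atom, `n ≥ 1`, `n·a` is well defined and `[0, n·a] ≠ {0, a, 2·a, …, n·a}`,
then there is an atom `b` with `b ∈ [0, n·a]` and `b ≠ a`. -/
theorem stmt7 {E : Type*} [EffectAlgebra E] [Finite E] (hhom : Homogeneous E)
    (hS : sharpSet E = {zero, one})
    (a : E) (ha : Atom a) (n : ℕ) (hn : 1 ≤ n) (hdef : nmulDef n a)
    (hne : Interval zero (nmul n a) ≠ { x : E | ∃ m ≤ n, x = nmul m a }) :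
    ∃ b : E, Atom b ∧ b ∈ Interval zero (nmul n a) ∧ b ≠ a := by
  by_contra! hcon
  refine hne (Set.Subset.antisymm (fun x hx => ?_) ?_)
  · exact exists_eq_nmul_of_le hdef (fun b hb hbn => hcon b hb ⟨zero_le b, hbn⟩) hx.2
  · rintro x ⟨m, hm, rfl⟩
    exact ⟨zero_le _, nmul_le_nmul hm hdef⟩

end EffectAlgebraPaper
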